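/- Let n ≥ 2 and let f : ℝⁿ → ℝ be a C² function whose graph has bounded mean curvature (sup_{x∈ℝⁿ} |H(x)| < ∞) and constant scalar curvature, i.e. there is a constant c ∈ ℝ with R(x) = c for all x. Then c = 0. -/

import Mathlib

open Metric Finset

/-- Coordinates of the gradient of `f` at `x`. -/
noncomputable def grad (n : ℕ) (f : EuclideanSpace ℝ (Fin n) → ℝ)
    (x : EuclideanSpace ℝ (Fin n)) : Fin n → ℝ :=
  fun i => fderiv ℝ f x (EuclideanSpace.single i 1)

/-- The Hessian matrix `D²f(x)`. -/
noncomputable def hess (n : ℕ) (f : EuclideanSpace ℝ (Fin n) → ℝ)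
    (x : EuclideanSpace ℝ (Fin n)) : Matrix (Fin n) (Fin n) ℝ :=
  Matrix.of fun i j =>
    fderiv ℝ (fun y => fderiv ℝ f y (EuclideanSpace.single j 1)) x (EuclideanSpace.single i 1)

/-- `|∇f(x)|²`. -/
noncomputable def gradSq (n : ℕ) (f : EuclideanSpace ℝ (Fin n) → ℝ)
    (x : EuclideanSpace ℝ (Fin n)) : ℝ :=
  ∑ i, grad n f x i ^ 2

/-- The shape operator of the graph of `f`, with respect to the upward unit normal:
`W(x) = (1+|∇f|²)^{-1/2} (Iₙ - ∇f ∇fᵀ/(1+|∇f|²)) D²f(x)`. -/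
noncomputable def shapeOp (n : ℕ) (f : EuclideanSpace ℝ (Fin n) → ℝ)
    (x : EuclideanSpace ℝ (Fin n)) : Matrix (Fin n) (Fin n) ℝ :=
  (Real.sqrt (1 + gradSq n f x))⁻¹ •
    (((1 : Matrix (Fin n) (Fin n) ℝ) -
      Matrix.of fun i j => grad n f x i * grad n f x j / (1 + gradSq n f x)) * hess n f x)

/-- The mean curvature `H(x) = tr W(x) / n`. -/
noncomputable def meanCurv (n : ℕ) (f : EuclideanSpace ℝ (Fin n) → ℝ)
    (x : EuclideanSpace ℝ (Fin n)) : ℝ :=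
  (shapeOp n f x).trace / n

/-- The scalar curvature `R(x) = ((tr W)² - tr(W²)) / (n(n-1))`. -/
noncomputable def scalarCurv (n : ℕ) (f : EuclideanSpace ℝ (Fin n) → ℝ)
    (x : EuclideanSpace ℝ (Fin n)) : ℝ :=
  ((shapeOp n f x).trace ^ 2 - (shapeOp n f x * shapeOp n f x).trace) /
    ((n : ℝ) * ((n : ℝ) - 1))

/-- The length `|A|(x) = √(tr(W(x)²))` of the second fundamental form. -/
noncomputable def normA (n : ℕ) (f : EuclideanSpace ℝ (Fin n) → ℝ)
    (x : EuclideanSpace ℝ (Fin n)) : ℝ :=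
  Real.sqrt ((shapeOp n f x * shapeOp n f x).trace)

open Matrix in
theorem trace_mul_transpose_sq_le {m k : Type*} [Fintype m] [Fintype k] (G : Matrix m k ℝ) :
    ((G * Gᵀ) * (G * Gᵀ)).trace ≤ (G * Gᵀ).trace ^ 2 := by
  simp only [trace, diag_apply, mul_apply (M := G * Gᵀ), sq, Finset.sum_mul_sum]
  refine Finset.sum_le_sum fun i _ => Finset.sum_le_sum fun j _ => ?_
  simpa [mul_apply, sq, mul_comm] using
    Finset.sum_mul_sq_le_sq_mul_sq Finset.univ (fun a => G i a) (fun a => G j a)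

open Matrix in
/-- If `M` and `Q` are positive semidefinite, then `M * Q` is similar to a positive semidefinite
matrix, so that its trace and the second elementary symmetric function of its eigenvalues are
nonnegative. -/
theorem trace_mul_posSemidef {m : Type*} [Fintype m] {M Q : Matrix m m ℝ}
    (hM : M.PosSemidef) (hQ : Q.PosSemidef) :
    0 ≤ (M * Q).trace ∧ ((M * Q) * (M * Q)).trace ≤ (M * Q).trace ^ 2 := by
  classical
  obtain ⟨C, rfl⟩ : ∃ C : Matrix m m ℝ, M = Cᵀ * C := by
    open scoped MatrixOrder ComplexOrder in
    simpa [star_eq_conjTranspose] using CStarAlgebra.nonneg_iff_eq_star_mul_self.mp hM.nonneg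
  obtain ⟨E, rfl⟩ : ∃ E : Matrix m m ℝ, Q = Eᵀ * E := by
    open scoped MatrixOrder ComplexOrder in
    simpa [star_eq_conjTranspose] using CStarAlgebra.nonneg_iff_eq_star_mul_self.mp hQ.nonneg
  have h1 : (Cᵀ * C * (Eᵀ * E)).trace = (E * Cᵀ * (E * Cᵀ)ᵀ).trace := by
    rw [← Matrix.mul_assoc, trace_mul_comm]
    simp [Matrix.mul_assoc]
  have h2 : ((Cᵀ * C * (Eᵀ * E)) * (Cᵀ * C * (Eᵀ * E))).trace
      = ((E * Cᵀ * (E * Cᵀ)ᵀ) * (E * Cᵀ * (E * Cᵀ)ᵀ)).trace := by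
    rw [← Matrix.mul_assoc, ← Matrix.mul_assoc, trace_mul_comm]
    simp [Matrix.mul_assoc]
  rw [h1, h2]
  refine ⟨?_, trace_mul_transpose_sq_le _⟩
  simpa using (posSemidef_self_mul_conjTranspose (E * Cᵀ)).trace_nonneg

open Matrix in
theorem trace_mul_mul_self_nonneg {m : Type*} [Fintype m] {M D : Matrix m m ℝ}
    (hM : M.PosSemidef) (hD : Dᵀ = D) : 0 ≤ ((M * D) * (M * D)).trace := by
  classical
  obtain ⟨C, rfl⟩ : ∃ C : Matrix m m ℝ, M = Cᵀ * C := by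
    open scoped MatrixOrder ComplexOrder in
    simpa [star_eq_conjTranspose] using CStarAlgebra.nonneg_iff_eq_star_mul_self.mp hM.nonneg
  have h : ((Cᵀ * C * D) * (Cᵀ * C * D)).trace = ((C * D * Cᵀ) * (C * D * Cᵀ)ᵀ).trace := by
    rw [Matrix.mul_assoc Cᵀ, Matrix.mul_assoc, trace_mul_comm]
    simp [Matrix.mul_assoc, hD]
  rw [h]
  simpa using (posSemidef_self_mul_conjTranspose (C * D * Cᵀ)).trace_nonneg

/-- The second derivative is nonpositive at a local maximum. -/
theorem IsLocalMax.deriv_deriv_nonpos {φ : ℝ → ℝ} {a : ℝ} (h : IsLocalMax φ a)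
    (hc : ContinuousAt φ a) : deriv (deriv φ) a ≤ 0 := by
  by_contra! hpos
  have hmin := isLocalMin_of_deriv_deriv_pos hpos h.deriv_eq_zero hc
  have hconst : φ =ᶠ[nhds a] fun _ => φ a := by
    filter_upwards [h, hmin] with x h1 h2 using le_antisymm h1 h2
  rw [hconst.deriv.deriv_eq] at hpos
  simp at hpos

/-- The inverse of the first fundamental form `1 + p pᵀ`. -/
noncomputable def invMetric {m : Type*} [DecidableEq m] [Fintype m] (p : m → ℝ) :
    Matrix m m ℝ :=
  1 - Matrix.of fun i j => p i * p j / (1 + ∑ k, p k ^ 2)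

open Matrix in
theorem invMetric_mul {m : Type*} [DecidableEq m] [Fintype m] (p : m → ℝ) :
    invMetric p * (1 + vecMulVec p p) = 1 := by
  have hq : 0 < 1 + ∑ k, p k ^ 2 := by positivity
  have h : (Matrix.of fun i j => p i * p j / (1 + ∑ k, p k ^ 2))
      = (1 + ∑ k, p k ^ 2)⁻¹ • vecMulVec p p := by
    ext i j; simp [vecMulVec_apply]; ring
  have h2 : vecMulVec p p * vecMulVec p p = (∑ k, p k ^ 2) • vecMulVec p p := by
    rw [vecMulVec_mul_vecMulVec]
    ext i j; simp [vecMulVec_apply, dotProduct, sq]; ring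
  rw [invMetric, h, Matrix.sub_mul, Matrix.mul_add, Matrix.smul_mul, Matrix.mul_add, h2]
  ext i j
  simp
  field_simp
  ring

open Matrix in
theorem posSemidef_invMetric {m : Type*} [DecidableEq m] [Fintype m] (p : m → ℝ) :
    (invMetric p).PosSemidef := by
  have hA : (1 + vecMulVec p p).PosSemidef := by
    refine PosSemidef.one.add ?_
    simpa using posSemidef_vecMulVec_self_star p
  rw [← inv_eq_left_inv (invMetric_mul p)]
  exact hA.inv

theorem shapeOp_eq {n : ℕ} (f : EuclideanSpace ℝ (Fin n) → ℝ) (x : EuclideanSpace ℝ (Fin n)) :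
    shapeOp n f x = (Real.sqrt (1 + gradSq n f x))⁻¹ • (invMetric (grad n f x) * hess n f x) :=
  rfl

theorem fderiv_apply_eq_fderiv_fderiv {n : ℕ} {f : EuclideanSpace ℝ (Fin n) → ℝ}
    (hf : ContDiff ℝ 2 f) (x u v : EuclideanSpace ℝ (Fin n)) :
    fderiv ℝ (fun y => fderiv ℝ f y v) x u = fderiv ℝ (fderiv ℝ f) x u v := by
  have h : DifferentiableAt ℝ (fderiv ℝ f) x :=
    (hf.fderiv_right (m := 1) (by norm_num)).differentiable (by norm_num) x
  simp [fderiv_clm_apply h (differentiableAt_const v)]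

theorem hess_apply {n : ℕ} {f : EuclideanSpace ℝ (Fin n) → ℝ}
    (hf : ContDiff ℝ 2 f) (x : EuclideanSpace ℝ (Fin n)) (i j : Fin n) :
    hess n f x i j = fderiv ℝ (fderiv ℝ f) x (EuclideanSpace.single i 1)
      (EuclideanSpace.single j 1) :=
  fderiv_apply_eq_fderiv_fderiv hf x _ _

open Matrix in
theorem transpose_hess {n : ℕ} {f : EuclideanSpace ℝ (Fin n) → ℝ}
    (hf : ContDiff ℝ 2 f) (x : EuclideanSpace ℝ (Fin n)) : (hess n f x)ᵀ = hess n f x := by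
  ext i j
  rw [transpose_apply, hess_apply hf, hess_apply hf]
  exact hf.contDiffAt.isSymmSndFDerivAt (by simp) _ _

theorem EuclideanSpace.eq_sum_single {n : ℕ} (v : EuclideanSpace ℝ (Fin n)) :
    v = ∑ i, v i • EuclideanSpace.single i (1 : ℝ) := by
  ext j; simp [Pi.single_apply]

open Matrix in
theorem dotProduct_hess_mulVec {n : ℕ} {f : EuclideanSpace ℝ (Fin n) → ℝ}
    (hf : ContDiff ℝ 2 f) (x v : EuclideanSpace ℝ (Fin n)) :
    v.ofLp ⬝ᵥ hess n f x *ᵥ v.ofLp = fderiv ℝ (fderiv ℝ f) x v v := by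
  conv_rhs => rw [EuclideanSpace.eq_sum_single v]
  simp only [map_sum, map_smul, _root_.sum_apply, _root_.smul_apply,
    ← hess_apply hf, dotProduct, mulVec, smul_eq_mul, Finset.mul_sum]
  rw [Finset.sum_comm]
  refine Finset.sum_congr rfl fun i _ => Finset.sum_congr rfl fun j _ => ?_
  ring

/-- A function `f` plus the height of the hemisphere of radius `r` attains its maximum over the
closed ball in the open ball. -/
theorem exists_isLocalMax_add_sqrt {n : ℕ} {f : EuclideanSpace ℝ (Fin n) → ℝ}
    (hf : ContDiff ℝ 2 f) {r : ℝ} (hr : 0 < r) :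
    ∃ x : EuclideanSpace ℝ (Fin n), ‖x‖ < r ∧
      IsLocalMax (fun y => f y + Real.sqrt (r ^ 2 - ‖y‖ ^ 2)) x := by
  have hcont : Continuous (fun y => f y + Real.sqrt (r ^ 2 - ‖y‖ ^ 2)) := by
    have := hf.continuous
    fun_prop
  obtain ⟨x, hx, hmax⟩ := (isCompact_closedBall (0 : EuclideanSpace ℝ (Fin n)) r).exists_isMaxOn
    ⟨0, by simp [hr.le]⟩ hcont.continuousOn
  have hxr : ‖x‖ ≤ r := by simpa using hx
  suffices hlt : ‖x‖ < r by
    refine ⟨x, hlt, ?_⟩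
    exact hmax.isLocalMax (closedBall_mem_nhds_of_mem (by simpa using hlt))
  refine lt_of_le_of_ne hxr fun hxeq => ?_
  have hψ : DifferentiableAt ℝ (fun t : ℝ => f ((1 - t) • x)) 0 := by
    have hd : Differentiable ℝ f := hf.differentiable (by norm_num)
    fun_prop
  obtain ⟨C, hC, hbound⟩ := hψ.isBigO_sub.exists_pos
  have hsmall : ∀ᶠ t : ℝ in nhdsWithin 0 (Set.Ioi 0), t < 1 ∧ C ^ 2 * t < r ^ 2 := by
    refine nhdsWithin_le_nhds (Filter.Eventually.and (eventually_lt_nhds one_pos) ?_)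
    have hc : ContinuousAt (fun t : ℝ => C ^ 2 * t) 0 := by fun_prop
    exact hc.eventually_lt continuousAt_const (by simpa using by positivity)
  obtain ⟨t, ⟨⟨ht1, htr⟩, hbt⟩, ht0⟩ :=
    ((hsmall.and (nhdsWithin_le_nhds hbound.bound)).and self_mem_nhdsWithin).exists
  replace ht0 : 0 < t := ht0
  have hnorm : ‖(1 - t) • x‖ = (1 - t) * r := by
    rw [norm_smul, hxeq, Real.norm_of_nonneg (by linarith)]
  have hm := hmax (show (1 - t) • x ∈ closedBall 0 r by
    rw [mem_closedBall_zero_iff, hnorm]; nlinarith)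
  simp only [Set.mem_ofPred_eq, hnorm, hxeq, sub_self, Real.sqrt_zero, add_zero] at hm
  simp only [sub_zero, one_smul, Real.norm_eq_abs, abs_of_pos ht0] at hbt
  have h1 : Real.sqrt (r ^ 2 - ((1 - t) * r) ^ 2) ≤ C * t := by
    linarith [neg_abs_le (f ((1 - t) • x) - f x)]
  have h2 := (Real.sqrt_le_left (by positivity)).mp h1
  have h3 : r ^ 2 * t ≤ r ^ 2 - ((1 - t) * r) ^ 2 := by
    nlinarith [mul_nonneg (mul_nonneg (sq_nonneg r) ht0.le) (sub_nonneg.mpr ht1.le)]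
  nlinarith

theorem hasDerivAt_sqrt_quadratic {a b c t : ℝ} (h : 0 < a + b * t + c * t ^ 2) :
    HasDerivAt (fun t => Real.sqrt (a + b * t + c * t ^ 2))
      ((b + 2 * c * t) / (2 * Real.sqrt (a + b * t + c * t ^ 2))) t := by
  have hq : HasDerivAt (fun t : ℝ => a + b * t + c * t ^ 2) (b + 2 * c * t) t := by
    have := (((hasDerivAt_id t).const_mul b).const_add a).add
      (((hasDerivAt_id t).pow 2).const_mul c)
    refine this.congr_deriv ?_
    simp; ring
  exact hq.sqrt h.ne'

theorem hasDerivAt_deriv_sqrt_quadratic {a b c : ℝ} (h : 0 < a) :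
    HasDerivAt (deriv fun t => Real.sqrt (a + b * t + c * t ^ 2))
      (c / Real.sqrt a - b ^ 2 / (4 * Real.sqrt a ^ 3)) 0 := by
  have hev : ∀ᶠ t : ℝ in nhds 0, 0 < a + b * t + c * t ^ 2 := by
    have hc : ContinuousAt (fun t : ℝ => a + b * t + c * t ^ 2) 0 := by fun_prop
    exact continuousAt_const.eventually_lt hc (by simpa using h)
  have h1 : deriv (fun t => Real.sqrt (a + b * t + c * t ^ 2)) =ᶠ[nhds 0]
      fun t => (b + 2 * c * t) / (2 * Real.sqrt (a + b * t + c * t ^ 2)) := by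
    filter_upwards [hev] with t ht using (hasDerivAt_sqrt_quadratic ht).deriv
  have hs : 0 < Real.sqrt a := Real.sqrt_pos.mpr h
  have hnum : HasDerivAt (fun t : ℝ => b + 2 * c * t) (2 * c) 0 := by
    simpa using ((hasDerivAt_id (0 : ℝ)).const_mul (2 * c)).const_add b
  have hden := (hasDerivAt_sqrt_quadratic (b := b) (c := c) (t := 0) (by simpa using h)).const_mul 2
  refine ((hnum.fun_div hden (by simpa using hs.ne')).congr_of_eventuallyEq h1).congr_deriv ?_
  simp
  field_simp
  ring

/-- At an interior maximum of `f` plus the height of the hemisphere of radius `r`, the gradient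
and Hessian of `f` are controlled by those of the lower hemisphere. -/
theorem IsLocalMax.fderiv_add_sqrt {n : ℕ} {f : EuclideanSpace ℝ (Fin n) → ℝ}
    (hf : ContDiff ℝ 2 f) {r : ℝ} {x : EuclideanSpace ℝ (Fin n)} (hx : ‖x‖ ^ 2 < r ^ 2)
    (hmax : IsLocalMax (fun y => f y + Real.sqrt (r ^ 2 - ‖y‖ ^ 2)) x)
    (v : EuclideanSpace ℝ (Fin n)) :
    fderiv ℝ f x v = inner ℝ x v / Real.sqrt (r ^ 2 - ‖x‖ ^ 2) ∧
      fderiv ℝ (fderiv ℝ f) x v v ≤ ‖v‖ ^ 2 / Real.sqrt (r ^ 2 - ‖x‖ ^ 2)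
        + inner ℝ x v ^ 2 / Real.sqrt (r ^ 2 - ‖x‖ ^ 2) ^ 3 := by
  set a := r ^ 2 - ‖x‖ ^ 2 with ha
  have ha0 : 0 < a := by linarith
  have hline (t : ℝ) : HasDerivAt (fun t : ℝ => x + t • v) v t := by
    simpa using ((hasDerivAt_id t).smul_const v).const_add x
  have hg (t : ℝ) : HasDerivAt (fun t : ℝ => f (x + t • v)) (fderiv ℝ f (x + t • v) v) t :=
    ((hf.differentiable (by norm_num) _).hasFDerivAt).comp_hasDerivAt t (hline t)
  have hg' : HasDerivAt (fun t : ℝ => fderiv ℝ f (x + t • v) v)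
      (fderiv ℝ (fderiv ℝ f) x v v) 0 := by
    have hd : Differentiable ℝ (fun y => fderiv ℝ f y v) :=
      ((hf.fderiv_right (m := 1) (by norm_num)).differentiable (by norm_num)).clm_apply
        (differentiable_const v)
    have := ((hd (x + (0 : ℝ) • v)).hasFDerivAt).comp_hasDerivAt 0 (hline 0)
    rwa [zero_smul, add_zero, fderiv_apply_eq_fderiv_fderiv hf] at this
  set s : ℝ → ℝ := fun t => Real.sqrt (a + (-2 * inner ℝ x v) * t + (-‖v‖ ^ 2) * t ^ 2) with hs
  have hφ : (fun t : ℝ => f (x + t • v) + Real.sqrt (r ^ 2 - ‖x + t • v‖ ^ 2))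
      = fun t => f (x + t • v) + s t := by
    funext t
    rw [hs, norm_add_sq_real, norm_smul, inner_smul_right, mul_pow, Real.norm_eq_abs, sq_abs, ha]
    congr 2
    ring
  have hloc : IsLocalMax (fun t => f (x + t • v) + s t) 0 := by
    rw [← hφ]
    have hc : ContinuousAt (fun t : ℝ => x + t • v) 0 := (hline 0).continuousAt
    exact IsLocalMax.comp_continuous (f := fun y => f y + Real.sqrt (r ^ 2 - ‖y‖ ^ 2))
      (g := fun t : ℝ => x + t • v) (by simpa using hmax) hc
  have hev : ∀ᶠ t : ℝ in nhds 0, 0 < a + (-2 * inner ℝ x v) * t + (-‖v‖ ^ 2) * t ^ 2 := by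
    have hc : ContinuousAt
        (fun t : ℝ => a + (-2 * inner ℝ x v) * t + (-‖v‖ ^ 2) * t ^ 2) 0 := by fun_prop
    exact continuousAt_const.eventually_lt hc (by simpa using ha0)
  have hs0 := hasDerivAt_sqrt_quadratic (a := a) (b := -2 * inner ℝ x v) (c := -‖v‖ ^ 2) (t := 0)
    (by simpa using ha0)
  have h1 := hloc.hasDerivAt_eq_zero ((hg 0).add hs0)
  have h2 := hloc.deriv_deriv_nonpos ((hg 0).add hs0).continuousAt
  have hderiv : deriv (fun t => f (x + t • v) + s t) =ᶠ[nhds 0]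
      fun t => fderiv ℝ f (x + t • v) v + deriv s t := by
    filter_upwards [hev] with t ht
    have hst : HasDerivAt s _ t := hasDerivAt_sqrt_quadratic ht
    rw [((hg t).fun_add hst).deriv, hst.deriv]
  have hs' := hasDerivAt_deriv_sqrt_quadratic (b := -2 * inner ℝ x v) (c := -‖v‖ ^ 2) ha0
  rw [hderiv.deriv_eq, (hg'.fun_add hs').deriv] at h2
  have hsa : 0 < Real.sqrt a := Real.sqrt_pos.mpr ha0
  constructor
  · simp at h1
    field_simp at h1 ⊢
    linarith
  · have e : (-2 * inner ℝ x v) ^ 2 / (4 * Real.sqrt a ^ 3)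
        = inner ℝ x v ^ 2 / Real.sqrt a ^ 3 := by
      field_simp; ring
    rw [e, neg_div] at h2
    linarith

open Matrix in
theorem posSemidef_hemisphere_sub_hess {n : ℕ} {f : EuclideanSpace ℝ (Fin n) → ℝ}
    (hf : ContDiff ℝ 2 f) {r : ℝ} (hr : 0 < r) {x : EuclideanSpace ℝ (Fin n)} (hx : ‖x‖ < r)
    (hmax : IsLocalMax (fun y => f y + Real.sqrt (r ^ 2 - ‖y‖ ^ 2)) x) :
    (r⁻¹ • (1 + vecMulVec (grad n f x) (grad n f x))
      - (Real.sqrt (1 + gradSq n f x))⁻¹ • hess n f x).PosSemidef := by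
  have hx2 : ‖x‖ ^ 2 < r ^ 2 := by gcongr
  have hcontact := IsLocalMax.fderiv_add_sqrt hf hx2 hmax
  set w := Real.sqrt (r ^ 2 - ‖x‖ ^ 2) with hw
  have hw0 : 0 < w := Real.sqrt_pos.mpr (by linarith)
  have hwsq : w ^ 2 = r ^ 2 - ‖x‖ ^ 2 := Real.sq_sqrt (by linarith)
  have hgrad (i : Fin n) : grad n f x i = x i / w := by
    rw [grad, (hcontact _).1, EuclideanSpace.inner_single_right]
    simp
  have hs : Real.sqrt (1 + gradSq n f x) = r / w := by
    have : 1 + gradSq n f x = (r / w) ^ 2 := by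
      simp only [gradSq, hgrad, div_pow, ← Finset.sum_div]
      rw [← EuclideanSpace.real_norm_sq_eq]
      field_simp
      linarith
    rw [this, Real.sqrt_sq (by positivity)]
  refine posSemidef_iff_dotProduct_mulVec.mpr ⟨?_, fun v => ?_⟩
  · simp [IsHermitian, transpose_hess hf]
  · obtain ⟨-, h2⟩ := hcontact (WithLp.toLp 2 v)
    rw [← dotProduct_hess_mulVec hf] at h2
    have hvv : v ⬝ᵥ v = ‖WithLp.toLp 2 v‖ ^ 2 := by
      rw [EuclideanSpace.real_norm_sq_eq]
      simp [dotProduct, sq]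
    have hpv : grad n f x ⬝ᵥ v = inner ℝ x (WithLp.toLp 2 v) / w := by
      simp only [dotProduct, hgrad, PiLp.inner_apply, Finset.sum_div]
      refine Finset.sum_congr rfl fun i _ => ?_
      simp
      ring
    have hexp : star v ⬝ᵥ ((r⁻¹ • (1 + vecMulVec (grad n f x) (grad n f x))
        - (r / w)⁻¹ • hess n f x) *ᵥ v)
        = r⁻¹ * (v ⬝ᵥ v + (grad n f x ⬝ᵥ v) ^ 2) - (r / w)⁻¹ * (v ⬝ᵥ hess n f x *ᵥ v) := by
      simp only [star_trivial, sub_mulVec, smul_mulVec, add_mulVec, one_mulVec,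
        dotProduct_sub, dotProduct_smul, dotProduct_add, smul_eq_mul, vecMulVec_mulVec,
        op_smul_eq_smul, dotProduct_comm v (grad n f x)]
      ring
    rw [hs, hexp, hvv, hpv]
    have h3 : w * (v ⬝ᵥ hess n f x *ᵥ v)
        ≤ ‖WithLp.toLp 2 v‖ ^ 2 + (inner ℝ x (WithLp.toLp 2 v) / w) ^ 2 := by
      refine (mul_le_mul_of_nonneg_left h2 hw0.le).trans_eq ?_
      field_simp
    have h4 : (r / w)⁻¹ * (v ⬝ᵥ hess n f x *ᵥ v) = r⁻¹ * (w * (v ⬝ᵥ hess n f x *ᵥ v)) := by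
      field_simp
    rw [h4, ← mul_sub]
    exact mul_nonneg (by positivity) (by linarith)

open Matrix in
/-- An entire graph has a point at which all principal curvatures are at most `ε`; this is what it
implies for the trace of the shape operator and of its square. -/
theorem exists_trace_shapeOp_le {n : ℕ} {f : EuclideanSpace ℝ (Fin n) → ℝ}
    (hf : ContDiff ℝ 2 f) {ε : ℝ} (hε : 0 < ε) :
    ∃ x, (shapeOp n f x).trace ≤ n * ε ∧
      ((n : ℝ) - 1) * (2 * ε * (shapeOp n f x).trace - n * ε ^ 2)
        ≤ (shapeOp n f x).trace ^ 2 - (shapeOp n f x * shapeOp n f x).trace := by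
  obtain ⟨x, hx, hmax⟩ := exists_isLocalMax_add_sqrt hf (inv_pos.mpr hε)
  have hQ := posSemidef_hemisphere_sub_hess hf (inv_pos.mpr hε) hx hmax
  have h := trace_mul_posSemidef (posSemidef_invMetric (grad n f x)) hQ
  have hP : invMetric (grad n f x) * (ε⁻¹⁻¹ • (1 + vecMulVec (grad n f x) (grad n f x))
      - (Real.sqrt (1 + gradSq n f x))⁻¹ • hess n f x) = ε • 1 - shapeOp n f x := by
    rw [shapeOp_eq, Matrix.mul_sub, Matrix.mul_smul, Matrix.mul_smul, invMetric_mul, inv_inv]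
  rw [hP] at h
  have h1 : (ε • (1 : Matrix (Fin n) (Fin n) ℝ) - shapeOp n f x).trace
      = n * ε - (shapeOp n f x).trace := by
    simp [mul_comm]
  have h2 : ((ε • (1 : Matrix (Fin n) (Fin n) ℝ) - shapeOp n f x)
      * (ε • (1 : Matrix (Fin n) (Fin n) ℝ) - shapeOp n f x)).trace
      = n * ε ^ 2 - 2 * ε * (shapeOp n f x).trace + (shapeOp n f x * shapeOp n f x).trace := by
    simp [Matrix.sub_mul, Matrix.mul_sub]
    ring
  rw [h1, h2] at h
  exact ⟨x, by linarith [h.1], by nlinarith [h.2]⟩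

theorem trace_shapeOp_mul_self_nonneg {n : ℕ} {f : EuclideanSpace ℝ (Fin n) → ℝ}
    (hf : ContDiff ℝ 2 f) (x : EuclideanSpace ℝ (Fin n)) :
    0 ≤ (shapeOp n f x * shapeOp n f x).trace := by
  have h := trace_mul_mul_self_nonneg (posSemidef_invMetric (grad n f x)) (transpose_hess hf x)
  rw [shapeOp_eq, Matrix.smul_mul, Matrix.mul_smul, Matrix.trace_smul, Matrix.trace_smul]
  exact smul_nonneg (by positivity) (smul_nonneg (by positivity) h)

theorem shapeOp_neg {n : ℕ} (f : EuclideanSpace ℝ (Fin n) → ℝ) (x : EuclideanSpace ℝ (Fin n)) :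
    shapeOp n (-f) x = -shapeOp n f x := by
  have hg : grad n (-f) x = -grad n f x := by
    ext i; simp [grad, fderiv_neg]
  have hh : hess n (-f) x = -hess n f x := by
    ext i j
    simp only [hess, Matrix.of_apply, Matrix.neg_apply, fderiv_neg, neg_apply]
    rw [fderiv_fun_neg]
    simp
  simp [shapeOp, gradSq, hg, hh]

theorem continuous_trace_shapeOp {n : ℕ} {f : EuclideanSpace ℝ (Fin n) → ℝ}
    (hf : ContDiff ℝ 2 f) : Continuous fun x => (shapeOp n f x).trace := by
  have h1 : ContDiff ℝ 1 (fderiv ℝ f) := hf.fderiv_right (by norm_num)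
  have hgrad : Continuous (grad n f) :=
    continuous_pi fun i => h1.continuous.clm_apply continuous_const
  have hgradSq : Continuous (gradSq n f) :=
    continuous_finsetSum _ fun i _ => (continuous_pi_iff.mp hgrad i).pow 2
  have hhess : Continuous (hess n f) := by
    refine continuous_matrix fun i j => ?_
    simp only [hess_apply hf]
    exact ((h1.continuous_fderiv (by norm_num)).clm_apply continuous_const).clm_apply
      continuous_const
  have hpos (x : EuclideanSpace ℝ (Fin n)) : 0 < 1 + gradSq n f x := by
    unfold gradSq; positivity
  have hsqrt : Continuous fun x => (Real.sqrt (1 + gradSq n f x))⁻¹ :=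
    (Real.continuous_sqrt.comp (continuous_const.add hgradSq)).inv₀
      fun x => (Real.sqrt_pos.mpr (hpos x)).ne'
  have hinv : Continuous fun x => invMetric (grad n f x) := by
    refine continuous_const.sub (continuous_matrix fun i j => ?_)
    exact ((continuous_pi_iff.mp hgrad i).mul (continuous_pi_iff.mp hgrad j)).div
      (continuous_const.add hgradSq) fun x => (hpos x).ne'
  simp only [shapeOp_eq]
  exact (hsqrt.smul (hinv.matrix_mul hhess)).matrix_trace

/-- The infimum of the absolute mean curvature of an entire graph is zero. -/
theorem exists_abs_trace_shapeOp_le {n : ℕ} {f : EuclideanSpace ℝ (Fin n) → ℝ}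
    (hf : ContDiff ℝ 2 f) {ε : ℝ} (hε : 0 < ε) :
    ∃ x, |(shapeOp n f x).trace| ≤ n * ε := by
  obtain ⟨x, hx, -⟩ := exists_trace_shapeOp_le hf hε
  obtain ⟨y, hy, -⟩ := exists_trace_shapeOp_le hf.neg hε
  have hy' : -(n * ε) ≤ (shapeOp n f y).trace := by
    have := shapeOp_neg f y
    rw [show (fun z => -f z) = -f from rfl, this, Matrix.trace_neg] at hy
    linarith
  by_cases hx' : -(n * ε) ≤ (shapeOp n f x).trace
  · exact ⟨x, abs_le.mpr ⟨hx', hx⟩⟩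
  have hnε : 0 ≤ n * ε := by positivity
  obtain ⟨z, hz⟩ := mem_range_of_exists_le_of_exists_ge (continuous_trace_shapeOp hf)
    ⟨x, (not_le.mp hx').le⟩ ⟨y, hy'⟩
  exact ⟨z, by simp [show (shapeOp n f z).trace = -(n * ε) from hz, abs_of_nonneg hnε]⟩

/-- **Corollary 1, second part.** An entire graph in `ℝ^{n+1}` with bounded mean
curvature and constant scalar curvature `c` must have `c = 0`. -/
theorem scalarCurv_eq_zero_of_constant_and_bounded_meanCurv
    (n : ℕ) (hn : 2 ≤ n)
    (f : EuclideanSpace ℝ (Fin n) → ℝ) (hf : ContDiff ℝ 2 f)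
    (hH : ∃ C : ℝ, ∀ x : EuclideanSpace ℝ (Fin n), |meanCurv n f x| ≤ C)
    (c : ℝ) (hR : ∀ x : EuclideanSpace ℝ (Fin n), scalarCurv n f x = c) :
    c = 0 := by
  obtain ⟨C, hC⟩ := hH
  have hC0 : 0 ≤ C := (abs_nonneg _).trans (hC 0)
  have hn2 : (2 : ℝ) ≤ n := by exact_mod_cast hn
  have hnn : 0 < (n : ℝ) * (n - 1) := by nlinarith
  have hS (x : EuclideanSpace ℝ (Fin n)) :
      (shapeOp n f x).trace ^ 2 - (shapeOp n f x * shapeOp n f x).trace = c * (n * (n - 1)) := by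
    rw [← hR x, scalarCurv, div_mul_cancel₀ _ hnn.ne']
  rcases lt_trichotomy c 0 with hc | hc | hc
  · exfalso
    set ε := min 1 (-c / (2 * (1 + 2 * C)))
    have hε0 : 0 < ε := lt_min one_pos (div_pos (by linarith) (by positivity))
    have hε1 : ε ≤ 1 := min_le_left _ _
    have hεc : ε * (2 * (1 + 2 * C)) ≤ -c :=
      (le_div_iff₀ (by positivity)).mp (min_le_right _ _)
    obtain ⟨x, -, hx⟩ := exists_trace_shapeOp_le hf hε0
    have hT : (shapeOp n f x).trace = n * meanCurv n f x := by
      rw [meanCurv, mul_div_cancel₀ _ (by positivity)]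
    rw [hS, hT] at hx
    have h1 : 2 * ε * meanCurv n f x - ε ^ 2 ≤ c := by
      refine le_of_mul_le_mul_right ?_ hnn
      linarith
    have h2 : ε * -C ≤ ε * meanCurv n f x :=
      mul_le_mul_of_nonneg_left (abs_le.mp (hC x)).1 hε0.le
    nlinarith
  · exact hc
  · exfalso
    set ε := min 1 (c / 4)
    have hε0 : 0 < ε := lt_min one_pos (by linarith)
    have hε2 : ε ^ 2 ≤ c / 4 := by
      nlinarith [min_le_left 1 (c / 4), min_le_right 1 (c / 4)]
    obtain ⟨x, hx⟩ := exists_abs_trace_shapeOp_le hf hε0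
    have h1 : (shapeOp n f x).trace ^ 2 ≤ (n * ε) ^ 2 := sq_le_sq' (abs_le.mp hx).1 (abs_le.mp hx).2
    have h2 : (n * ε) ^ 2 ≤ n ^ 2 * (c / 4) := by
      rw [mul_pow]; gcongr
    have h3 : c * n ≤ c * (2 * (n - 1)) := by gcongr; linarith
    have h4 : c * n * n ≤ c * (2 * (n - 1)) * n := by gcongr
    nlinarith [hS x, trace_shapeOp_mul_self_nonneg hf x, mul_pos hc hnn]
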